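/- arXiv:2603.20641 — 3 statements merged into one kernel-verified Lean document; each statement's English description precedes it below -/
import Mathlib

section
/- Let A be an n×n real matrix, B an m×n real matrix, and r ≥ 0 an index such that the Krylov subspaces satisfy V_r = V_{r+1}, where V_k = span{ (Aᵀ)^j Bᵀ v : 0 ≤ j ≤ k, v ∈ ℝ^m }. Then there exist m×m real matrices C_0, …, C_r such that B A^{r+1} = ∑_{k=0}^{r} C_k B A^k. -/
open Matrix Finset

/-- The observable Krylov subspace `V_k = span{ (Aᵀ)^j Bᵀ v : 0 ≤ j ≤ k, v ∈ ℝ^m } ⊆ ℝ^n`. -/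
noncomputable def krylov {n m : ℕ} (A : Matrix (Fin n) (Fin n) ℝ) (B : Matrix (Fin m) (Fin n) ℝ)
    (k : ℕ) : Submodule ℝ (Fin n → ℝ) :=
  Submodule.span ℝ {x | ∃ j ≤ k, ∃ v : Fin m → ℝ, x = ((Aᵀ ^ j) * Bᵀ).mulVec v}

/-- Every element of `V_r` is a combination `∑ k, (Aᵀ)^k Bᵀ w_k` with `0 ≤ k ≤ r`. -/
theorem exists_sum_of_mem_krylov {n m : ℕ} {A : Matrix (Fin n) (Fin n) ℝ}
    {B : Matrix (Fin m) (Fin n) ℝ} {r : ℕ} {x : Fin n → ℝ} (hx : x ∈ krylov A B r) :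
    ∃ w : Fin (r + 1) → Fin m → ℝ, x = ∑ k : Fin (r + 1), ((Aᵀ ^ (k : ℕ)) * Bᵀ).mulVec (w k) := by
  induction hx using Submodule.span_induction with
  | mem x hx =>
    obtain ⟨j, hj, v, rfl⟩ := hx
    refine ⟨Pi.single ⟨j, Nat.lt_succ_of_le hj⟩ v, ?_⟩
    rw [Finset.sum_eq_single ⟨j, Nat.lt_succ_of_le hj⟩]
    · simp
    · intro k _ hk
      simp [Pi.single_eq_of_ne hk]
    · simp
  | zero => exact ⟨0, by simp⟩
  | add x y _ _ hx hy =>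
    obtain ⟨w, rfl⟩ := hx
    obtain ⟨w', rfl⟩ := hy
    exact ⟨w + w', by simp [Matrix.mulVec_add, Finset.sum_add_distrib]⟩
  | smul a x _ hx =>
    obtain ⟨w, rfl⟩ := hx
    exact ⟨a • w, by simp [Matrix.mulVec_smul, Finset.smul_sum]⟩

/-- If the Krylov subspaces satisfy `V_r = V_{r+1}`, then there are `m×m` matrices
`C_0, …, C_r` such that `B A^{r+1} = ∑_{k=0}^{r} C_k B A^k`. -/
theorem exists_closure {n m : ℕ} (A : Matrix (Fin n) (Fin n) ℝ)
    (B : Matrix (Fin m) (Fin n) ℝ) (r : ℕ)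
    (h : krylov A B r = krylov A B (r + 1)) :
    ∃ C : Fin (r + 1) → Matrix (Fin m) (Fin m) ℝ,
      B * A ^ (r + 1) = ∑ k : Fin (r + 1), C k * B * A ^ (k : ℕ) := by
  have hmem (i : Fin m) :
      ((Aᵀ ^ (r + 1)) * Bᵀ).mulVec (Pi.single i 1) ∈ krylov A B r := by
    rw [h]
    exact Submodule.subset_span ⟨r + 1, le_rfl, _, rfl⟩
  choose w hw using fun i => exists_sum_of_mem_krylov (hmem i)
  refine ⟨fun k => Matrix.of fun i => w i k, ?_⟩
  ext i j
  have hij := congrFun (hw i) j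
  simp only [← Matrix.transpose_pow, ← Matrix.transpose_mul, Matrix.mulVec_single_one,
    Matrix.mulVec_transpose, Finset.sum_apply] at hij
  rw [Matrix.sum_apply]
  refine hij.trans (Finset.sum_congr rfl fun k _ => ?_)
  rw [Matrix.mul_assoc]
  rfl
end

section
/- Let A be an n×n real matrix and B an m×n real matrix with stabilization index r, i.e., r is the smallest index with V_r = V_{r+1} for the Krylov subspaces V_k = span{ (Aᵀ)^j Bᵀ v : 0 ≤ j ≤ k, v ∈ ℝ^m }. If s ≥ 0 and there exist m×m real matrices D_0, …, D_s with B A^{s+1} = ∑_{k=0}^{s} D_k B A^k, then s ≥ r. In other words, r+1 is the minimal order of a matrix-coefficient linear closure of the observable dynamics. -/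
open Matrix Finset

theorem krylov_eq_succ_of_closure {n m : ℕ} (A : Matrix (Fin n) (Fin n) ℝ)
    (B : Matrix (Fin m) (Fin n) ℝ) (s : ℕ) (D : Fin (s + 1) → Matrix (Fin m) (Fin m) ℝ)
    (hD : B * A ^ (s + 1) = ∑ k : Fin (s + 1), D k * B * A ^ (k : ℕ)) :
    krylov A B s = krylov A B (s + 1) := by
  have hT : Aᵀ ^ (s + 1) * Bᵀ = ∑ k : Fin (s + 1), Aᵀ ^ (k : ℕ) * Bᵀ * (D k)ᵀ := by
    simpa [Matrix.transpose_mul, Matrix.transpose_pow, Matrix.transpose_sum, Matrix.mul_assoc]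
      using congrArg Matrix.transpose hD
  apply le_antisymm
  · apply Submodule.span_mono
    rintro x ⟨j, hj, v, rfl⟩
    exact ⟨j, by omega, v, rfl⟩
  · apply Submodule.span_le.2
    rintro x ⟨j, hj, v, rfl⟩
    rcases Nat.le_succ_iff.1 hj with hj | rfl
    · exact Submodule.subset_span ⟨j, hj, v, rfl⟩
    · rw [hT, Matrix.sum_mulVec]
      refine Submodule.sum_mem _ fun k _ => Submodule.subset_span
        ⟨k, Nat.lt_succ_iff.1 k.2, (D k)ᵀ.mulVec v, ?_⟩
      rw [Matrix.mulVec_mulVec]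

/-- **Minimality of the closure order.** Let `r` be the stabilization index, i.e. the
smallest index with `V_r = V_{r+1}`. If `s ≥ 0` admits matrices `D_0, …, D_s` with
`B A^{s+1} = ∑_{k=0}^{s} D_k B A^k`, then `s ≥ r`; so `r + 1` is the minimal order of a
matrix-coefficient linear closure of the observable dynamics. -/
theorem closure_minimal_order {n m : ℕ} (A : Matrix (Fin n) (Fin n) ℝ)
    (B : Matrix (Fin m) (Fin n) ℝ) (r : ℕ)
    (hstab : krylov A B r = krylov A B (r + 1))
    (hmin : ∀ k < r, krylov A B k ≠ krylov A B (k + 1))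
    (s : ℕ) (D : Fin (s + 1) → Matrix (Fin m) (Fin m) ℝ)
    (hD : B * A ^ (s + 1) = ∑ k : Fin (s + 1), D k * B * A ^ (k : ℕ)) :
    r ≤ s := by
  by_contra! h
  exact hmin s h (krylov_eq_succ_of_closure A B s D hD)
end

section
/- Let ψ_1, …, ψ_q : ℝ → ℝ be real-analytic functions that are linearly independent over ℝ. Then the set of points (t_1, …, t_q) ∈ ℝ^q at which the q×q evaluation matrix M with entries M_{ij} = ψ_j(t_i) is singular (det M = 0) has Lebesgue measure zero in ℝ^q. -/
open MeasureTheory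

/-- The zero set of a real-analytic function on `ℝ` that is not identically zero is null. -/
theorem volume_zeros_eq_zero_of_analyticOnNhd {f : ℝ → ℝ} (hf : AnalyticOnNhd ℝ f Set.univ)
    (h0 : f ≠ 0) : volume {x | f x = 0} = 0 := by
  rcases hf.eqOn_zero_or_eventually_ne_zero_of_preconnected isPreconnected_univ with h | h
  · exact absurd (funext fun x => h (Set.mem_univ x)) h0
  · have h' := ae_restrict_le_codiscreteWithin (μ := (volume : Measure ℝ)) MeasurableSet.univ h
    rw [Measure.restrict_univ] at h'
    simpa [mem_ae_iff, Set.compl_ofPred] using h'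

/-- If `ψ_1, …, ψ_q : ℝ → ℝ` are real-analytic and linearly independent over `ℝ`, then the
set of points `(t_1, …, t_q) ∈ ℝ^q` where the evaluation matrix `M_{ij} = ψ_j(t_i)` is
singular has Lebesgue measure zero. -/
theorem analytic_evaluation_matrix_ae_invertible {q : ℕ} (ψ : Fin q → ℝ → ℝ)
    (hψa : ∀ j, AnalyticOnNhd ℝ (ψ j) Set.univ)
    (hψli : LinearIndependent ℝ ψ) :
    volume {t : Fin q → ℝ | Matrix.det (Matrix.of fun i j => ψ j (t i)) = 0} = 0 := by
  induction q with
  | zero => simp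
  | succ n ih =>
    have hminor := ih (fun j => ψ j.succ) (fun j => hψa _)
      (hψli.comp _ (Fin.succ_injective n))
    have hcont (j) : Continuous (ψ j) :=
      continuousOn_univ.1 (hψa j).continuousOn
    let S : Set (ℝ × (Fin n → ℝ)) :=
      {p | Matrix.det (Matrix.of fun i j => ψ j ((Fin.cons p.1 p.2 : Fin (n + 1) → ℝ) i)) = 0}
    have hS : MeasurableSet S := by
      refine (isClosed_eq (Continuous.matrix_det ?_) continuous_const).measurableSet
      refine continuous_matrix fun i j => (hcont j).comp ?_
      refine Fin.cases ?_ (fun i => ?_) i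
      · exact continuous_fst
      · exact (continuous_apply i).comp continuous_snd
    have hmp := volume_preserving_piFinSuccAbove (fun _ : Fin (n + 1) => ℝ) 0
    have hpre : {t : Fin (n + 1) → ℝ | Matrix.det (Matrix.of fun i j => ψ j (t i)) = 0} =
        MeasurableEquiv.piFinSuccAbove (fun _ : Fin (n + 1) => ℝ) 0 ⁻¹' S := by
      ext t
      have : (Fin.cons (t 0) (fun i => t i.succ) : Fin (n + 1) → ℝ) = t := Fin.cons_self_tail t
      change _ ↔ Matrix.det (Matrix.of fun i j =>
        ψ j ((Fin.cons (t 0) (fun i => t i.succ) : Fin (n + 1) → ℝ) i)) = 0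
      rw [this]
      rfl
    rw [hpre, hmp.measure_preimage hS.nullMeasurableSet, Measure.volume_eq_prod,
      Measure.prod_apply_symm hS, lintegral_eq_zero_iff (measurable_measure_prodMk_right hS)]
    have hminor' : ∀ᵐ s : Fin n → ℝ,
        Matrix.det (Matrix.of fun i j : Fin n => ψ j.succ (s i)) ≠ 0 := by
      simpa [ae_iff] using hminor
    filter_upwards [hminor'] with s hs
    let c : Fin (n + 1) → ℝ := fun j =>
      (-1) ^ (j : ℕ) * Matrix.det (Matrix.of fun i k : Fin n => ψ (j.succAbove k) (s i))
    have hdet (x : ℝ) : Matrix.det (Matrix.of fun i j =>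
        ψ j ((Fin.cons x s : Fin (n + 1) → ℝ) i)) = (∑ j, c j • ψ j) x := by
      rw [Matrix.det_succ_row_zero, Finset.sum_apply]
      refine Finset.sum_congr rfl fun j _ => ?_
      simp only [c, Pi.smul_apply, smul_eq_mul, Matrix.of_apply, Fin.cons_zero]
      rw [mul_right_comm]
      rfl
    have hne : ∑ j, c j • ψ j ≠ 0 := fun h => hs <| by
      simpa [c] using Fintype.linearIndependent_iff.1 hψli c h 0
    have han : AnalyticOnNhd ℝ (∑ j, c j • ψ j) Set.univ :=
      Finset.analyticOnNhd_sum _ fun j _ => (hψa j).const_smul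
    simpa [S, hdet] using volume_zeros_eq_zero_of_analyticOnNhd han hne
end
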